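/- For every z ∈ ℂ ∖ ((−∞,−1] ∪ [1,+∞)) one has the identity (6·Γ(2/3)/Γ(1/3)²)·((z+1)/2)^{1/3}·₂F₁(1/3, 2/3; 4/3; (z+1)/2) − 1 = (2√3·Γ(2/3)/(√π·Γ(1/6)))·z·₂F₁(1/2, 2/3; 3/2; z²), where the cube root is the principal power. (Note that for such z one has (z+1)/2 ∈ ℂ ∖ ((−∞,0] ∪ [1,+∞)) and z² ∈ ℂ ∖ [1,+∞), so both sides are well defined.) -/

import Mathlib

open Complex Set Filter

/-- The Gauss hypergeometric function `₂F₁(p,q;r;z)` defined via the Euler integral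
(principal branches of all complex powers). -/
noncomputable def hyp (p q r z : ℂ) : ℂ :=
  Complex.Gamma r / (Complex.Gamma q * Complex.Gamma (r - q)) *
    ∫ t in (0:ℝ)..1, (t : ℂ) ^ (q - 1) * (1 - (t : ℂ)) ^ (r - q - 1) * (1 - (t : ℂ) * z) ^ (-p)

/-- The two slits `(-∞,-1] ∪ [1,+∞)` on the real axis, viewed inside `ℂ`. -/
def slit : Set ℂ := {z | z.im = 0 ∧ (z.re ≤ -1 ∨ 1 ≤ z.re)}

/-- The slit plane `D = ℂ ∖ ((-∞,-1] ∪ [1,+∞))`. -/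
def Dslit : Set ℂ := slitᶜ

/-- `g(z) = (2√3·Γ(2/3)/(√π·Γ(1/6)))·z·₂F₁(1/2,2/3;3/2;z²)`. -/
noncomputable def g (z : ℂ) : ℂ :=
  2 * (Real.sqrt 3 : ℂ) * Complex.Gamma (2/3) /
      ((Real.sqrt Real.pi : ℂ) * Complex.Gamma (1/6)) *
    z * hyp (1/2) (2/3) (3/2) (z ^ 2)

open MeasureTheory intervalIntegral

lemma one_sub_ofReal_mul_mem_slitPlane {w : ℂ} (hw : 1 - w ∈ slitPlane) {t : ℝ}
    (ht : t ∈ Icc (0 : ℝ) 1) : 1 - (t : ℂ) * w ∈ slitPlane := by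
  have h := starConvex_one_slitPlane.add_smul_sub_mem hw ht.1 ht.2
  rw [real_smul] at h
  convert h using 1
  ring

lemma intervalIntegrable_mul_one_sub_mul_cpow {b c w : ℂ} (hb : 0 < b.re) (hcb : 0 < (c - b).re)
    (hw : 1 - w ∈ slitPlane) (s : ℂ) {f : ℝ → ℂ} (hf : Continuous f) :
    IntervalIntegrable (fun t : ℝ => (t : ℂ) ^ (b - 1) * (1 - (t : ℂ)) ^ (c - b - 1) *
      (f t * (1 - (t : ℂ) * w) ^ s)) volume 0 1 := by
  refine (betaIntegral_convergent hb hcb).mul_continuousOn (hf.continuousOn.mul ?_)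
  rw [uIcc_of_le zero_le_one]
  exact ContinuousOn.cpow_const (by fun_prop) fun t ht => one_sub_ofReal_mul_mem_slitPlane hw ht

/-- Differentiation of the Euler integral under the integral sign. -/
lemma hasDerivAt_eulerIntegral (p : ℂ) {b c w : ℂ} (hb : 0 < b.re) (hcb : 0 < (c - b).re)
    (hw : 1 - w ∈ slitPlane) :
    HasDerivAt (fun w : ℂ => ∫ t in (0 : ℝ)..1,
        (t : ℂ) ^ (b - 1) * (1 - (t : ℂ)) ^ (c - b - 1) * (1 - (t : ℂ) * w) ^ (-p))
      (∫ t in (0 : ℝ)..1, (t : ℂ) ^ (b - 1) * (1 - (t : ℂ)) ^ (c - b - 1) *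
        (p * t * (1 - (t : ℂ) * w) ^ (-p - 1))) w := by
  have hopen : IsOpen {w : ℂ | 1 - w ∈ slitPlane} :=
    isOpen_slitPlane.preimage (by fun_prop : Continuous fun w : ℂ => 1 - w)
  obtain ⟨ε, hε, hball⟩ := Metric.nhds_basis_closedBall.mem_iff.1 (hopen.mem_nhds hw)
  have hcont : ContinuousOn (fun x : ℝ × ℂ => p * x.1 * (1 - (x.1 : ℂ) * x.2) ^ (-p - 1))
      (Icc (0 : ℝ) 1 ×ˢ Metric.closedBall w ε) := by
    refine ContinuousOn.mul (by fun_prop) (ContinuousOn.cpow_const (by fun_prop) ?_)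
    exact fun x hx => one_sub_ofReal_mul_mem_slitPlane (hball hx.2) hx.1
  obtain ⟨C, hC⟩ := (isCompact_Icc.prod
    (isCompact_closedBall w ε)).exists_bound_of_continuousOn hcont
  have hint : ∀ v : ℂ, 1 - v ∈ slitPlane → IntervalIntegrable (fun t : ℝ =>
      (t : ℂ) ^ (b - 1) * (1 - (t : ℂ)) ^ (c - b - 1) * (1 - (t : ℂ) * v) ^ (-p)) volume 0 1 := by
    intro v hv
    simpa using intervalIntegrable_mul_one_sub_mul_cpow hb hcb hv (-p)
      (f := fun _ : ℝ => (1 : ℂ)) continuous_const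
  have hmem : ∀ t : ℝ, t ∈ uIoc (0 : ℝ) 1 → t ∈ Icc (0 : ℝ) 1 := by
    intro t ht
    rw [uIoc_of_le zero_le_one] at ht
    exact Ioc_subset_Icc_self ht
  refine (hasDerivAt_integral_of_dominated_loc_of_deriv_le
    (F := fun (v : ℂ) (t : ℝ) =>
      (t : ℂ) ^ (b - 1) * (1 - (t : ℂ)) ^ (c - b - 1) * (1 - (t : ℂ) * v) ^ (-p))
    (F' := fun (v : ℂ) (t : ℝ) => (t : ℂ) ^ (b - 1) * (1 - (t : ℂ)) ^ (c - b - 1) *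
      (p * t * (1 - (t : ℂ) * v) ^ (-p - 1)))
    (bound := fun t : ℝ => ‖(t : ℂ) ^ (b - 1) * (1 - (t : ℂ)) ^ (c - b - 1)‖ * C)
    (Metric.closedBall_mem_nhds w hε) ?_ (hint w hw) ?_ ?_ ?_ ?_).2
  · filter_upwards [Metric.closedBall_mem_nhds w hε] with v hv
    exact (hint v (hball hv)).aestronglyMeasurable_restrict_uIoc
  · exact (intervalIntegrable_mul_one_sub_mul_cpow hb hcb hw (-p - 1)
      (f := fun t : ℝ => p * t) (by fun_prop)).aestronglyMeasurable_restrict_uIoc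
  · refine .of_forall fun t ht v hv => ?_
    rw [norm_mul]
    exact mul_le_mul_of_nonneg_left (hC (t, v) ⟨hmem t ht, hv⟩) (norm_nonneg _)
  · exact (betaIntegral_convergent hb hcb).norm.mul_const C
  · refine .of_forall fun t ht v hv => ?_
    have h := (((hasDerivAt_id v).const_mul (t : ℂ)).const_sub 1).cpow_const (c := -p)
      (one_sub_ofReal_mul_mem_slitPlane (hball hv) (hmem t ht))
    refine (h.const_mul _).congr_deriv ?_
    simp only [id_eq]
    ring

lemma Gamma_div_mul_betaIntegral {b c : ℂ} (hb : 0 < b.re) (hcb : 0 < (c - b).re) :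
    Gamma c / (Gamma b * Gamma (c - b)) * betaIntegral b (c - b) = 1 := by
  have h := Gamma_mul_Gamma_eq_betaIntegral hb hcb
  rw [add_sub_cancel] at h
  rw [div_mul_eq_mul_div, ← h]
  exact div_self (mul_ne_zero (Gamma_ne_zero_of_re_pos hb) (Gamma_ne_zero_of_re_pos hcb))

/-- `₂F₁` is differentiable in `w`, and `p F + w F' = p F(p + 1)`. -/
lemma hasDerivAt_hyp (p : ℂ) {b c w : ℂ} (hb : 0 < b.re) (hcb : 0 < (c - b).re)
    (hw : 1 - w ∈ slitPlane) :
    ∃ D, HasDerivAt (hyp p b c) D w ∧ p * hyp p b c w + w * D = p * hyp (p + 1) b c w := by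
  refine ⟨_, (hasDerivAt_eulerIntegral p hb hcb hw).const_mul _, ?_⟩
  have h0 := intervalIntegrable_mul_one_sub_mul_cpow hb hcb hw (-p)
      (f := fun _ : ℝ => (1 : ℂ)) continuous_const
  have h1 := intervalIntegrable_mul_one_sub_mul_cpow hb hcb hw (-p - 1)
      (f := fun t : ℝ => p * t) (by fun_prop)
  simp only [one_mul] at h0
  simp only [hyp]
  rw [mul_left_comm p, mul_left_comm w, mul_left_comm p, ← mul_add]
  congr 1
  simp only [← intervalIntegral.integral_const_mul]
  rw [← intervalIntegral.integral_add (h0.const_mul p) (h1.const_mul w)]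
  refine intervalIntegral.integral_congr fun t ht => ?_
  rw [uIcc_of_le zero_le_one] at ht
  have hne := slitPlane_ne_zero (one_sub_ofReal_mul_mem_slitPlane hw ht)
  have hs : (1 - (t : ℂ) * w) ^ (-p) = (1 - (t : ℂ) * w) * (1 - (t : ℂ) * w) ^ (-p - 1) := by
    rw [cpow_sub _ _ hne, cpow_one]
    field_simp
  have he : -(p + 1) = -p - 1 := by ring
  simp only [hs, he]
  ring

/-- `₂F₁(c, b; c; w) = (1 - w) ^ (-b)`: the Euler integral times `(1 - w) ^ b` has zero derivative,
since that derivative is the integral of a total derivative. -/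
lemma hyp_self {b c w : ℂ} (hb : 0 < b.re) (hcb : 0 < (c - b).re) (hw : 1 - w ∈ slitPlane) :
    hyp c b c w = (1 - w) ^ (-b) := by
  have hb0 : b ≠ 0 := fun h => by simp [h] at hb
  have hcb0 : c - b ≠ 0 := fun h => by simp [h] at hcb
  set S := {w : ℂ | 1 - w ∈ slitPlane} with hS
  have hopen : IsOpen S :=
    isOpen_slitPlane.preimage (by fun_prop : Continuous fun w : ℂ => 1 - w)
  have h0S : (0 : ℂ) ∈ S := by simp [hS]
  have hstar : StarConvex ℝ (0 : ℂ) S := by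
    rw [starConvex_zero_iff]
    intro x hx a ha0 ha1
    rw [real_smul]
    exact one_sub_ofReal_mul_mem_slitPlane hx ⟨ha0, ha1⟩
  have hderiv : ∀ v ∈ S, HasDerivAt (fun v : ℂ => (1 - v) ^ b * ∫ t in (0 : ℝ)..1,
      (t : ℂ) ^ (b - 1) * (1 - (t : ℂ)) ^ (c - b - 1) * (1 - (t : ℂ) * v) ^ (-c)) 0 v := by
    intro v hv
    have hvne := slitPlane_ne_zero hv
    have hI := hasDerivAt_eulerIntegral c hb hcb hv
    have hode : (1 - v) * (∫ t in (0 : ℝ)..1, (t : ℂ) ^ (b - 1) * (1 - (t : ℂ)) ^ (c - b - 1) *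
        (c * t * (1 - (t : ℂ) * v) ^ (-c - 1))) = b * ∫ t in (0 : ℝ)..1,
        (t : ℂ) ^ (b - 1) * (1 - (t : ℂ)) ^ (c - b - 1) * (1 - (t : ℂ) * v) ^ (-c) := by
      have h0 := intervalIntegrable_mul_one_sub_mul_cpow hb hcb hv (-c)
          (f := fun _ : ℝ => (1 : ℂ)) continuous_const
      have h1 := intervalIntegrable_mul_one_sub_mul_cpow hb hcb hv (-c - 1)
          (f := fun t : ℝ => c * t) (by fun_prop)
      simp only [one_mul] at h0
      have h2 := (h0.const_mul b).sub (h1.const_mul (1 - v))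
      have hftc := integral_eq_sub_of_hasDerivAt_of_le (zero_le_one (α := ℝ))
        (f := fun t : ℝ => (t : ℂ) ^ b * (1 - (t : ℂ)) ^ (c - b) * (1 - (t : ℂ) * v) ^ (-c))
        ?_ ?_ h2
      · rw [intervalIntegral.integral_sub (h0.const_mul b) (h1.const_mul (1 - v)),
          intervalIntegral.integral_const_mul, intervalIntegral.integral_const_mul] at hftc
        simp only [ofReal_one, sub_self, zero_cpow hcb0, ofReal_zero, zero_cpow hb0, mul_zero,
          zero_mul] at hftc
        exact (sub_eq_zero.1 hftc).symm
      · refine ContinuousOn.mul (Continuous.continuousOn (.mul ?_ ?_)) ?_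
        · exact continuous_ofReal_cpow_const hb
        · have := (continuous_ofReal_cpow_const hcb).comp
            (by fun_prop : Continuous fun t : ℝ => 1 - t)
          simpa [Function.comp_def] using this
        · exact ContinuousOn.cpow_const (by fun_prop)
            fun t ht => one_sub_ofReal_mul_mem_slitPlane hv ht
      · intro t ht
        have hmem := one_sub_ofReal_mul_mem_slitPlane hv (Ioo_subset_Icc_self ht)
        have ht0 : (t : ℂ) ∈ slitPlane := ofReal_mem_slitPlane.2 ht.1
        have ht1 : 1 - (t : ℂ) ∈ slitPlane := by
          rw [← ofReal_one, ← ofReal_sub]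
          exact ofReal_mem_slitPlane.2 (sub_pos.2 ht.2)
        have hid := hasDerivAt_id (t : ℂ)
        have h := (((hid.cpow_const (c := b) ht0).mul
          ((hid.const_sub 1).cpow_const (c := c - b) ht1)).mul
          (((hid.mul_const v).const_sub 1).cpow_const (c := -c) hmem)).comp_ofReal
        refine h.congr_deriv ?_
        simp only [id_eq, Pi.mul_apply]
        have e : ∀ {x : ℂ} (s : ℂ), x ∈ slitPlane → x ^ s = x * x ^ (s - 1) := by
          intro x s hx
          rw [cpow_sub _ _ (slitPlane_ne_zero hx), cpow_one]
          field_simp [slitPlane_ne_zero hx]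
        rw [e b ht0, e (c - b) ht1, e (-c) hmem]
        ring
    refine (((hasDerivAt_id v).const_sub 1).cpow_const (c := b) hv |>.mul hI).congr_deriv ?_
    simp only [id_eq]
    have hs : (1 - v) ^ b = (1 - v) * (1 - v) ^ (b - 1) := by
      rw [cpow_sub _ _ hvne, cpow_one]
      field_simp
    rw [hs]
    linear_combination (1 - v) ^ (b - 1) * hode
  have hconst := hopen.is_const_of_deriv_eq_zero
    (hstar.isPathConnected h0S).isConnected.isPreconnected
    (fun v hv => (hderiv v hv).differentiableAt.differentiableWithinAt)
    (fun v hv => (hderiv v hv).deriv) hw h0S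
  simp only [sub_zero, one_cpow, mul_zero, mul_one, one_mul] at hconst
  have hbeta := Gamma_div_mul_betaIntegral hb hcb
  rw [betaIntegral, ← hconst] at hbeta
  have hne : (1 - w) ^ b ≠ 0 := by simp [cpow_eq_zero_iff, slitPlane_ne_zero hw]
  rw [hyp, cpow_neg, ← one_div, eq_div_iff hne]
  linear_combination hbeta

lemma continuousOn_hyp_Icc {p b c : ℂ} (hp : 0 ≤ p.re) (hb : 0 < b.re)
    (hcbp : 0 < (c - b - p).re) :
    ContinuousOn (fun x : ℝ => hyp p b c x) (Icc 0 1) := by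
  have hne : ∀ᵐ t : ℝ, t ≠ 1 := Measure.ae_ne volume 1
  intro x₀ hx₀
  refine ContinuousWithinAt.mul continuousWithinAt_const ?_
  refine intervalIntegral.continuousWithinAt_of_dominated_interval
    (bound := fun t : ℝ => ‖(t : ℂ) ^ (b - 1) * (1 - (t : ℂ)) ^ (c - b - p - 1)‖) ?_ ?_
    (betaIntegral_convergent hb hcbp).norm ?_
  · exact .of_forall fun x => Measurable.aestronglyMeasurable (by fun_prop)
  · filter_upwards [self_mem_nhdsWithin] with x hx
    filter_upwards [hne] with t ht1 ht
    rw [uIoc_of_le zero_le_one] at ht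
    have h1t : 0 < 1 - t := sub_pos.2 (lt_of_le_of_ne ht.2 ht1)
    have hle : 1 - t ≤ 1 - t * x := by nlinarith [ht.1, hx.2]
    have h1tc : (1 - (t : ℂ)) ≠ 0 := by exact_mod_cast h1t.ne'
    have he : c - b - p - 1 = (c - b - 1) + -p := by ring
    rw [he, cpow_add _ _ h1tc, ← mul_assoc, norm_mul, norm_mul _ ((1 - (t : ℂ)) ^ (-p))]
    refine mul_le_mul_of_nonneg_left ?_ (norm_nonneg _)
    rw [← ofReal_mul, ← ofReal_one, ← ofReal_sub, ← ofReal_sub,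
      norm_cpow_eq_rpow_re_of_pos h1t, norm_cpow_eq_rpow_re_of_pos (h1t.trans_le hle)]
    exact Real.rpow_le_rpow_of_nonpos h1t hle (by simpa using hp)
  · filter_upwards [hne] with t ht1 ht
    rw [uIoc_of_le zero_le_one] at ht
    have h1t : 0 < 1 - t * x₀ := by nlinarith [ht.1, hx₀.2, lt_of_le_of_ne ht.2 ht1]
    have hmem : 1 - (t : ℂ) * (x₀ : ℂ) ∈ slitPlane := by
      rw [← ofReal_mul, ← ofReal_one, ← ofReal_sub]
      exact ofReal_mem_slitPlane.2 h1t
    refine ContinuousWithinAt.mul continuousWithinAt_const (ContinuousAt.continuousWithinAt ?_)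
    exact ContinuousAt.cpow (by fun_prop) continuousAt_const hmem

/-- Gauss's summation formula. -/
lemma hyp_one {p b c : ℂ} (hp : 0 ≤ p.re) (hb : 0 < b.re) (hcbp : 0 < (c - b - p).re) :
    hyp p b c 1 = Gamma c * Gamma (c - b - p) / (Gamma (c - b) * Gamma (c - p)) := by
  have hint : ∫ t in (0 : ℝ)..1,
      (t : ℂ) ^ (b - 1) * (1 - (t : ℂ)) ^ (c - b - 1) * (1 - (t : ℂ) * 1) ^ (-p) =
      betaIntegral b (c - b - p) := by
    refine integral_congr_ae ?_
    filter_upwards [Measure.ae_ne volume (1 : ℝ)] with t ht1 ht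
    have h1tc : (1 - (t : ℂ)) ≠ 0 := sub_ne_zero.2 fun h => ht1 (by exact_mod_cast h.symm)
    have he : c - b - p - 1 = (c - b - 1) + -p := by ring
    rw [he, cpow_add _ _ h1tc, mul_one, mul_assoc]
  have hbeta := Gamma_mul_Gamma_eq_betaIntegral hb hcbp
  have he : b + (c - b - p) = c - p := by ring
  rw [he] at hbeta
  have hcp : Gamma (c - p) ≠ 0 := Gamma_ne_zero_of_re_pos (by
    simp only [sub_re] at hcbp ⊢
    linarith)
  have hcb : Gamma (c - b) ≠ 0 := Gamma_ne_zero_of_re_pos (by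
    simp only [sub_re] at hcbp ⊢
    linarith)
  have hbne : Gamma b ≠ 0 := Gamma_ne_zero_of_re_pos hb
  rw [hyp, hint]
  field_simp
  linear_combination -Gamma c * hbeta

lemma mul_cpow_of_arg_add_mem {x y : ℂ} (hx : x ≠ 0) (hy : y ≠ 0)
    (h : arg x + arg y ∈ Ioc (-Real.pi) Real.pi) (s : ℂ) : (x * y) ^ s = x ^ s * y ^ s := by
  rw [cpow_def_of_ne_zero (mul_ne_zero hx hy), cpow_def_of_ne_zero hx, cpow_def_of_ne_zero hy,
    (log_mul_eq_add_log_iff hx hy).2 h, add_mul, exp_add]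

lemma mul_one_sub_cpow {w : ℂ} (hw : w ∈ slitPlane) (hw1 : 1 - w ∈ slitPlane) (s : ℂ) :
    (w * (1 - w)) ^ s = w ^ s * (1 - w) ^ s := by
  refine mul_cpow_of_arg_add_mem (slitPlane_ne_zero hw) (slitPlane_ne_zero hw1) ?_ s
  have him : (1 - w).im = -w.im := by simp
  have h1 := neg_pi_lt_arg w
  have h2 := neg_pi_lt_arg (1 - w)
  have h3 := arg_le_pi w
  have h4 := arg_le_pi (1 - w)
  rcases lt_trichotomy w.im 0 with h | h | h
  · have h5 := arg_neg_iff.2 h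
    have h6 : 0 ≤ arg (1 - w) := arg_nonneg_iff.2 (by linarith)
    constructor <;> linarith
  · have e1 : arg w = 0 := arg_eq_zero_iff.2 ⟨by
      rcases mem_slitPlane_iff.1 hw with h' | h'
      · exact h'.le
      · exact absurd h h', h⟩
    have e2 : arg (1 - w) = 0 := arg_eq_zero_iff.2 ⟨by
      rcases mem_slitPlane_iff.1 hw1 with h' | h'
      · exact h'.le
      · exact absurd (by linarith) h', by linarith⟩
    rw [e1, e2, add_zero]
    exact ⟨by linarith [Real.pi_pos], Real.pi_pos.le⟩
  · have h5 : 0 ≤ arg w := arg_nonneg_iff.2 h.le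
    have h6 : arg (1 - w) < 0 := arg_neg_iff.2 (by linarith)
    constructor <;> linarith

/-- The derivative of `w ^ p * ₂F₁(p, b; p + 1; w)`. -/
lemma hasDerivAt_cpow_mul_hyp {p b w : ℂ} (hb : 0 < b.re) (hpb : 0 < (p + 1 - b).re)
    (hw : w ∈ slitPlane) (hw1 : 1 - w ∈ slitPlane) :
    HasDerivAt (fun w => w ^ p * hyp p b (p + 1) w) (p * w ^ (p - 1) * (1 - w) ^ (-b)) w := by
  obtain ⟨D, hD, h⟩ := hasDerivAt_hyp p hb hpb hw1
  rw [hyp_self hb hpb hw1] at h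
  refine (((hasDerivAt_id w).cpow_const hw).mul hD).congr_deriv ?_
  have hs : w ^ p = w * w ^ (p - 1) := by
    have := slitPlane_ne_zero hw
    rw [cpow_sub _ _ this, cpow_one]
    field_simp
  simp only [id_eq, hs]
  linear_combination w ^ (p - 1) * h

/-- The derivative of `z * ₂F₁(1/2, b; 3/2; z²)`. -/
lemma hasDerivAt_mul_hyp_sq {b z : ℂ} (hb : 0 < b.re) (hcb : 0 < (3 / 2 - b).re)
    (hz : 1 - z ^ 2 ∈ slitPlane) :
    HasDerivAt (fun z => z * hyp (1 / 2) b (3 / 2) (z ^ 2)) ((1 - z ^ 2) ^ (-b)) z := by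
  obtain ⟨D, hD, h⟩ := hasDerivAt_hyp (1 / 2) hb hcb hz
  have he : (1 / 2 + 1 : ℂ) = 3 / 2 := by norm_num
  rw [he, hyp_self hb hcb hz] at h
  refine ((hasDerivAt_id z).mul (hD.comp z (hasDerivAt_pow 2 z))).congr_deriv ?_
  simp only [id_eq, Function.comp_apply]
  push_cast
  linear_combination 2 * h

/-- By the symmetry `w ↦ 1 - w`, the value at `1/2` is half of the value at `1`. -/
lemma two_mul_cpow_mul_hyp_half {p : ℂ} (hp : 0 < p.re) (hp1 : p.re < 1) :
    2 * ((1 / 2 : ℂ) ^ p * hyp p (1 - p) (p + 1) (1 / 2)) = hyp p (1 - p) (p + 1) 1 := by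
  have hp0 : p ≠ 0 := fun h => by simp [h] at hp
  have hb : 0 < (1 - p).re := by simpa using hp1
  have hcb : 0 < (p + 1 - (1 - p)).re := by
    simp only [sub_re, add_re, one_re]
    linarith
  have hcbp : 0 < (p + 1 - (1 - p) - p).re := by
    simp only [sub_re, add_re, one_re]
    linarith
  set F : ℂ → ℂ := fun w => w ^ p * hyp p (1 - p) (p + 1) w with hF
  have hcont : ContinuousOn (fun x : ℝ => F x) (Icc 0 1) :=
    (continuous_ofReal_cpow_const hp).continuousOn.mul (continuousOn_hyp_Icc hp.le hb hcbp)
  have hsub : Icc (0 : ℝ) (1 / 2) ⊆ Icc 0 1 := Icc_subset_Icc_right (by norm_num)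
  have hcont' : ContinuousOn (fun x : ℝ => F x + F ((1 - x : ℝ) : ℂ)) (Icc 0 (1 / 2)) := by
    refine (hcont.mono hsub).add (hcont.comp (f := fun x : ℝ => 1 - x) (by fun_prop) ?_)
    intro x hx
    exact ⟨by linarith [hx.2], by linarith [hx.1]⟩
  have hderiv : ∀ x ∈ Ioo (0 : ℝ) (1 / 2),
      HasDerivAt (fun x : ℝ => F x + F ((1 - x : ℝ) : ℂ)) 0 x := by
    intro x hx
    have hx0 : (x : ℂ) ∈ slitPlane := ofReal_mem_slitPlane.2 hx.1
    have hx1 : 1 - (x : ℂ) ∈ slitPlane := by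
      rw [← ofReal_one, ← ofReal_sub]
      exact ofReal_mem_slitPlane.2 (by linarith [hx.2])
    have hx2 : 1 - (1 - (x : ℂ)) ∈ slitPlane := by simpa using hx0
    have h1 := hasDerivAt_cpow_mul_hyp hb hcb hx0 hx1
    have h2 := (hasDerivAt_cpow_mul_hyp hb hcb hx1 hx2).comp (x : ℂ)
      ((hasDerivAt_id (x : ℂ)).const_sub 1)
    have h3 := (h1.add h2).comp_ofReal
    simp only [ofReal_sub, ofReal_one]
    refine h3.congr_deriv ?_
    have e : -(1 - p) = p - 1 := by ring
    rw [e, sub_sub_cancel]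
    ring
  have hftc := integral_eq_sub_of_hasDerivAt_of_le (by norm_num : (0 : ℝ) ≤ 1 / 2) hcont' hderiv
    intervalIntegrable_const
  simp only [intervalIntegral.integral_zero, hF] at hftc
  norm_num [zero_cpow hp0] at hftc
  norm_num
  linear_combination -hftc

lemma isOpen_Dslit : IsOpen Dslit := by
  have h : Dslit = {z : ℂ | 1 - z ∈ slitPlane} ∩ {z : ℂ | z + 1 ∈ slitPlane} := by
    ext z
    simp only [Dslit, slit, mem_compl_iff, mem_ofPred_eq, mem_inter_iff, mem_slitPlane_iff, sub_re,
      add_re, one_re, sub_im, add_im, one_im]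
    grind
  rw [h]
  exact (isOpen_slitPlane.preimage (by fun_prop : Continuous fun w : ℂ => 1 - w)).inter
    (isOpen_slitPlane.preimage (by fun_prop : Continuous fun w : ℂ => w + 1))

lemma zero_mem_Dslit : (0 : ℂ) ∈ Dslit := by
  norm_num [Dslit, slit]

lemma starConvex_Dslit : StarConvex ℝ (0 : ℂ) Dslit := by
  rw [starConvex_zero_iff]
  intro x hx a ha0 ha1
  simp only [Dslit, slit, mem_compl_iff, mem_ofPred_eq, real_smul, mul_im, mul_re, ofReal_re,
    ofReal_im, zero_mul, sub_zero, add_zero, not_and, not_or, not_le] at hx ⊢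
  intro h
  rcases mul_eq_zero.1 h with h | h
  · simp [h]
  · constructor <;> nlinarith [hx h]

lemma half_add_one_mem_slitPlane {z : ℂ} (hz : z ∈ Dslit) : (z + 1) / 2 ∈ slitPlane := by
  have e : ((z + 1) / 2).re = (z.re + 1) / 2 ∧ ((z + 1) / 2).im = z.im / 2 := by
    constructor <;> norm_num
  simp only [Dslit, slit, mem_compl_iff, mem_ofPred_eq] at hz
  rw [mem_slitPlane_iff, e.1, e.2]
  grind

lemma neg_mem_Dslit {z : ℂ} (hz : z ∈ Dslit) : -z ∈ Dslit := by
  simp only [Dslit, slit, mem_compl_iff, mem_ofPred_eq, neg_re, neg_im] at hz ⊢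
  grind

lemma one_sub_half_add_one_mem_slitPlane {z : ℂ} (hz : z ∈ Dslit) :
    1 - (z + 1) / 2 ∈ slitPlane := by
  convert half_add_one_mem_slitPlane (neg_mem_Dslit hz) using 1
  ring

lemma one_sub_sq_eq (z : ℂ) : 1 - z ^ 2 = 4 * ((z + 1) / 2 * (1 - (z + 1) / 2)) := by ring

lemma one_sub_sq_mem_slitPlane {z : ℂ} (hz : z ∈ Dslit) : 1 - z ^ 2 ∈ slitPlane := by
  simp only [Dslit, slit, mem_compl_iff, mem_ofPred_eq, not_and, not_or, not_le] at hz
  rw [mem_slitPlane_iff]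
  simp only [sub_re, sub_im, one_re, one_im, sq, mul_re, mul_im]
  by_cases hi : z.im = 0
  · left
    have := hz hi
    rw [hi]
    nlinarith
  · by_cases hr : z.re = 0
    · left
      rw [hr]
      nlinarith [sq_nonneg z.im]
    · right
      intro h
      exact mul_ne_zero hr hi (by linarith)

lemma one_sub_sq_cpow {z : ℂ} (hz : z ∈ Dslit) (s : ℂ) :
    (1 - z ^ 2) ^ s = 4 ^ s * (((z + 1) / 2) ^ s * (1 - (z + 1) / 2) ^ s) := by
  have h1 := half_add_one_mem_slitPlane hz
  have h2 := one_sub_half_add_one_mem_slitPlane hz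
  have h4 : arg (4 : ℂ) = 0 := by simp
  rw [one_sub_sq_eq, mul_cpow_of_arg_add_mem (by norm_num)
    (mul_ne_zero (slitPlane_ne_zero h1) (slitPlane_ne_zero h2)) _ s, mul_one_sub_cpow h1 h2]
  rw [h4, zero_add]
  exact ⟨neg_pi_lt_arg _, arg_le_pi _⟩

lemma Gamma_constants :
    2 * (Real.sqrt 3 : ℂ) * Gamma (2 / 3) / ((Real.sqrt Real.pi : ℂ) * Gamma (1 / 6)) *
      4 ^ (-(2 / 3) : ℂ) = Gamma (2 / 3) / Gamma (1 / 3) ^ 2 := by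
  have h3 : (Real.sqrt 3 : ℂ) ^ 2 = 3 := by
    rw [← ofReal_pow, Real.sq_sqrt (by norm_num)]
    norm_num
  have hpi : (Real.sqrt Real.pi : ℂ) ^ 2 = Real.pi := by
    rw [← ofReal_pow, Real.sq_sqrt Real.pi_pos.le]
  have hdup := Gamma_mul_Gamma_add_half (1 / 6)
  have hrefl := Gamma_mul_Gamma_one_sub (1 / 3)
  have hsin : sin ((Real.pi : ℂ) * (1 / 3)) = Real.sqrt 3 / 2 := by
    have := Real.sin_pi_div_three
    rw [show (Real.pi : ℂ) * (1 / 3) = ((Real.pi / 3 : ℝ) : ℂ) by push_cast; ring,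
      ← ofReal_sin, this]
    push_cast
    rfl
  rw [hsin] at hrefl
  norm_num at hdup hrefl
  have hk0 : (2 : ℂ) ^ (2 / 3 : ℂ) ≠ 0 := by simp [cpow_eq_zero_iff]
  have hk : ((2 : ℂ) ^ (2 / 3 : ℂ)) ^ 3 = 4 := by
    rw [← cpow_nat_mul]
    norm_num
  have h4 : (4 : ℂ) ^ (-(2 / 3) : ℂ) = 2 ^ (2 / 3 : ℂ) / 4 := by
    have e := mul_cpow_ofReal_nonneg (zero_le_two (α := ℝ)) (zero_le_two (α := ℝ)) (-(2 / 3) : ℂ)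
    norm_num at e
    rw [e, cpow_neg, eq_div_iff (by norm_num)]
    field_simp
    exact hk.symm
  have g1 : Gamma (1 / 3) ≠ 0 := Gamma_ne_zero_of_re_pos (by norm_num)
  have g2 : Gamma (2 / 3) ≠ 0 := Gamma_ne_zero_of_re_pos (by norm_num)
  have g3 : Gamma (1 / 6) ≠ 0 := Gamma_ne_zero_of_re_pos (by norm_num)
  have hpi0 : (Real.sqrt Real.pi : ℂ) ≠ 0 := fun h => by
    rw [h] at hpi
    simp [Real.pi_ne_zero, eq_comm] at hpi
  have h30 : (Real.sqrt 3 : ℂ) ≠ 0 := fun h => by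
    rw [h] at h3
    norm_num at h3
  rw [← hpi] at hrefl
  rw [h4]
  field_simp at hrefl ⊢
  refine mul_right_cancel₀ g2 ?_
  linear_combination 2 * Gamma (1 / 3) * 2 ^ (2 / 3 : ℂ) * hrefl -
    4 * (Real.sqrt Real.pi : ℂ) * hdup

theorem stmt_0 :
    ∀ z ∈ Dslit,
      6 * Complex.Gamma (2/3) / (Complex.Gamma (1/3)) ^ 2 *
          ((z + 1) / 2) ^ ((1 : ℂ)/3) * hyp (1/3) (2/3) (4/3) ((z + 1) / 2) - 1
        = g z := by
  intro z hz
  have e43 : (1 / 3 + 1 : ℂ) = 4 / 3 := by norm_num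
  have hb : 0 < (2 / 3 : ℂ).re := by norm_num
  have hcb : 0 < (1 / 3 + 1 - 2 / 3 : ℂ).re := by norm_num
  have hcb' : 0 < (3 / 2 - 2 / 3 : ℂ).re := by norm_num
  set K := 6 * Complex.Gamma (2/3) / (Complex.Gamma (1/3)) ^ 2 with hK
  have hleft : ∀ v ∈ Dslit, HasDerivAt
      (fun v : ℂ => K * ((v + 1) / 2) ^ ((1 : ℂ)/3) * hyp (1/3) (2/3) (4/3) ((v + 1) / 2) - 1)
      (Gamma (2 / 3) / Gamma (1 / 3) ^ 2 *
        (((v + 1) / 2) ^ (-(2 / 3) : ℂ) * (1 - (v + 1) / 2) ^ (-(2 / 3) : ℂ))) v := by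
    intro v hv
    have h := (hasDerivAt_cpow_mul_hyp hb hcb (half_add_one_mem_slitPlane hv)
      (one_sub_half_add_one_mem_slitPlane hv)).comp v (((hasDerivAt_id v).add_const 1).div_const 2)
    rw [e43] at h
    have e : (1 / 3 - 1 : ℂ) = -(2 / 3) := by norm_num
    rw [e] at h
    simp only [mul_assoc K]
    refine ((h.const_mul K).sub_const 1).congr_deriv ?_
    rw [hK]
    ring
  have hright : ∀ v ∈ Dslit, HasDerivAt g (Gamma (2 / 3) / Gamma (1 / 3) ^ 2 *
        (((v + 1) / 2) ^ (-(2 / 3) : ℂ) * (1 - (v + 1) / 2) ^ (-(2 / 3) : ℂ))) v := by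
    intro v hv
    have h := (hasDerivAt_mul_hyp_sq hb hcb' (one_sub_sq_mem_slitPlane hv)).const_mul
      (2 * (Real.sqrt 3 : ℂ) * Gamma (2 / 3) / ((Real.sqrt Real.pi : ℂ) * Gamma (1 / 6)))
    rw [one_sub_sq_cpow hv, ← mul_assoc, Gamma_constants] at h
    simp only [← mul_assoc _ _ (hyp _ _ _ _)] at h
    exact h
  refine isOpen_Dslit.eqOn_of_deriv_eq
    (starConvex_Dslit.isPathConnected zero_mem_Dslit).isConnected.isPreconnected
    (fun v hv => (hleft v hv).differentiableAt.differentiableWithinAt)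
    (fun v hv => (hright v hv).differentiableAt.differentiableWithinAt)
    (fun v hv => (hleft v hv).deriv.trans (hright v hv).deriv.symm) zero_mem_Dslit ?_ hz
  have hhalf := two_mul_cpow_mul_hyp_half (p := 1 / 3) (by norm_num) (by norm_num)
  rw [hyp_one (by norm_num) (by norm_num) (by norm_num), Gamma_add_one _ (by norm_num)] at hhalf
  norm_num [Gamma_one] at hhalf
  have g1 : Gamma (1 / 3) ≠ 0 := Gamma_ne_zero_of_re_pos (by norm_num)
  have g2 : Gamma (2 / 3) ≠ 0 := Gamma_ne_zero_of_re_pos (by norm_num)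
  simp only [g, hK]
  norm_num
  have hnorm : 3 * Gamma (2 / 3) / Gamma (1 / 3) ^ 2 *
      (1 / 3 * Gamma (1 / 3) * Gamma (1 / 3) / Gamma (2 / 3)) = 1 := by
    field_simp
  linear_combination 3 * Gamma (2 / 3) / Gamma (1 / 3) ^ 2 * hhalf + hnorm
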